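/- Let λ₁, λ₂, λ₃, λ₄ be real numbers with arctan λ₁ + arctan λ₂ + arctan λ₃ + arctan λ₄ ∈ (π, 3π/2). Then σ₂ > 2, where σ₂ = Σ_{i<j} λᵢλⱼ. -/

import Mathlib

open Real

/-- Newton's inequality between `σ₁`, `σ₂` and `σ₃` of four real numbers. -/
lemma nine_mul_esymm_one_mul_esymm_three_le (a b c d : ℝ) :
    9 * ((a + b + c + d) * (a * b * c + a * b * d + a * c * d + b * c * d)) ≤
      4 * (a * b + a * c + a * d + b * c + b * d + c * d) ^ 2 := by
  linarith [sq_nonneg (a * b - c * d), sq_nonneg (a * c - b * d), sq_nonneg (a * d - b * c),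
    sq_nonneg (a * (b - c)), sq_nonneg (a * (b - d)), sq_nonneg (a * (c - d)),
    sq_nonneg (b * (a - c)), sq_nonneg (b * (a - d)), sq_nonneg (b * (c - d)),
    sq_nonneg (c * (a - b)), sq_nonneg (c * (a - d)), sq_nonneg (c * (b - d)),
    sq_nonneg (d * (a - b)), sq_nonneg (d * (a - c)), sq_nonneg (d * (b - c))]

lemma esymm_two_pos_of_nonpos {a b c d : ℝ} (hd : d ≤ 0) (ha : 0 < a + d) (hb : 0 < b + d)
    (hc : 0 < c + d) : 0 < a * b + a * c + a * d + b * c + b * d + c * d := by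
  have h₁ : 0 < a * (b + d) := mul_pos (by linarith) hb
  have h₂ : 0 < b * (c + d) := mul_pos (by linarith) hc
  have h₃ : 0 < c * (a + d) := mul_pos (by linarith) ha
  linarith

lemma esymm_two_pos_of_pairwise_add_pos {a b c d : ℝ} (hab : 0 < a + b) (hac : 0 < a + c)
    (had : 0 < a + d) (hbc : 0 < b + c) (hbd : 0 < b + d) (hcd : 0 < c + d) :
    0 < a * b + a * c + a * d + b * c + b * d + c * d := by
  rcases le_or_gt a 0 with ha | ha
  · linarith [esymm_two_pos_of_nonpos (a := b) (b := c) (c := d) ha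
      (by linarith) (by linarith) (by linarith)]
  rcases le_or_gt b 0 with hb | hb
  · linarith [esymm_two_pos_of_nonpos (a := a) (b := c) (c := d) hb
      (by linarith) (by linarith) (by linarith)]
  rcases le_or_gt c 0 with hc | hc
  · linarith [esymm_two_pos_of_nonpos (a := a) (b := b) (c := d) hc
      (by linarith) (by linarith) (by linarith)]
  rcases le_or_gt d 0 with hd | hd
  · exact esymm_two_pos_of_nonpos hd had hbd hcd
  positivity

lemma sin_arctan_eq_mul_cos_arctan (x : ℝ) : sin (arctan x) = x * cos (arctan x) := by
  rw [← tan_mul_cos (cos_arctan_pos x).ne', tan_arctan]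

lemma sin_sum_four_arctan (a b c d : ℝ) :
    sin (arctan a + arctan b + arctan c + arctan d) =
      cos (arctan a) * cos (arctan b) * cos (arctan c) * cos (arctan d) *
        (a + b + c + d - (a * b * c + a * b * d + a * c * d + b * c * d)) := by
  simp only [sin_add, cos_add, sin_arctan_eq_mul_cos_arctan]
  ring

lemma add_pos_of_arctan_add_pos {x y : ℝ} (h : 0 < arctan x + arctan y) : 0 < x + y := by
  have : arctan (-y) < arctan x := by rw [arctan_neg]; linarith
  linarith [arctan_lt_arctan_iff.mp this]

theorem stmt_7 (l₁ l₂ l₃ l₄ : ℝ)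
    (h : arctan l₁ + arctan l₂ + arctan l₃ + arctan l₄ ∈
      Set.Ioo π (3 * π / 2)) :
    l₁ * l₂ + l₁ * l₃ + l₁ * l₄ + l₂ * l₃ + l₂ * l₄ + l₃ * l₄ > 2 := by
  obtain ⟨hl, hu⟩ := h
  have t₁ := arctan_lt_pi_div_two l₁
  have t₂ := arctan_lt_pi_div_two l₂
  have t₃ := arctan_lt_pi_div_two l₃
  have t₄ := arctan_lt_pi_div_two l₄
  have h₁₂ : 0 < l₁ + l₂ := add_pos_of_arctan_add_pos (by linarith)
  have h₁₃ : 0 < l₁ + l₃ := add_pos_of_arctan_add_pos (by linarith)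
  have h₁₄ : 0 < l₁ + l₄ := add_pos_of_arctan_add_pos (by linarith)
  have h₂₃ : 0 < l₂ + l₃ := add_pos_of_arctan_add_pos (by linarith)
  have h₂₄ : 0 < l₂ + l₄ := add_pos_of_arctan_add_pos (by linarith)
  have h₃₄ : 0 < l₃ + l₄ := add_pos_of_arctan_add_pos (by linarith)
  have hσ₂ := esymm_two_pos_of_pairwise_add_pos h₁₂ h₁₃ h₁₄ h₂₃ h₂₄ h₃₄
  have hsin : sin (arctan l₁ + arctan l₂ + arctan l₃ + arctan l₄) < 0 := by
    rw [← neg_pos, ← sin_sub_pi]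
    exact sin_pos_of_pos_of_lt_pi (by linarith) (by linarith [pi_pos])
  rw [sin_sum_four_arctan] at hsin
  have hcos : 0 < cos (arctan l₁) * cos (arctan l₂) * cos (arctan l₃) * cos (arctan l₄) :=
    mul_pos (mul_pos (mul_pos (cos_arctan_pos _) (cos_arctan_pos _)) (cos_arctan_pos _))
      (cos_arctan_pos _)
  have hσ₃ := (pos_iff_neg_of_mul_neg hsin).mp hcos
  have hσ₁ : 0 < l₁ + l₂ + l₃ + l₄ := by linarith
  have hnewton := nine_mul_esymm_one_mul_esymm_three_le l₁ l₂ l₃ l₄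
  have hσ₁₃ := mul_lt_mul_of_pos_left (sub_neg.mp hσ₃) hσ₁
  have hσ₁₂ : 8 * (l₁ * l₂ + l₁ * l₃ + l₁ * l₄ + l₂ * l₃ + l₂ * l₄ + l₃ * l₄) ≤
      3 * ((l₁ + l₂ + l₃ + l₄) * (l₁ + l₂ + l₃ + l₄)) := by
    linarith [sq_nonneg (l₁ - l₂), sq_nonneg (l₁ - l₃), sq_nonneg (l₁ - l₄),
      sq_nonneg (l₂ - l₃), sq_nonneg (l₂ - l₄), sq_nonneg (l₃ - l₄)]
  generalize l₁ * l₂ + l₁ * l₃ + l₁ * l₄ + l₂ * l₃ + l₂ * l₄ + l₃ * l₄ = σ₂ at *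
  nlinarith
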